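/- For all integers n ≥ 2, 1 ≤ i ≤ n−1, and 1 ≤ j ≤ n, the function h(n,i) = 2i(n−i+1)/(n(n+1)(n+2)) satisfies the bulk hole recurrence: h(n,i) = R(n−1, i)·h(n,n) + (∑_{x=1}^{j−1} h(n−1, i)·h(n−x, n−x)) + h(n−1, i)·R(n−j, n−j), where R(m,k) = k(k+1)/((m+1)(m+2)). -/

import Mathlib

/-- Closed form of the hole probability `h(n,i) = 2i(n-i+1)/(n(n+1)(n+2))`. -/
noncomputable def holeP (n i : ℤ) : ℚ :=
  ((2 * i * (n - i + 1) : ℤ) : ℚ) / ((n * (n + 1) * (n + 2) : ℤ) : ℚ)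

/-- Closed form of the right-exit probability (with the convention `R(0,0) = 0`). -/
noncomputable def sgrR (m k : ℤ) : ℚ :=
  ((k * (k + 1) : ℤ) : ℚ) / (((m + 1) * (m + 2) : ℤ) : ℚ)

theorem holeP_self {m : ℤ} (hm : 0 < m) :
    holeP m m = 2 / (((m : ℚ) + 1) * (m + 2)) := by
  have h : (0 : ℚ) < m := by exact_mod_cast hm
  unfold holeP
  push_cast
  field_simp
  ring

theorem sgrR_self {m : ℤ} (hm : 0 ≤ m) : sgrR m m = (m : ℚ) / (m + 2) := by
  have h : (0 : ℚ) ≤ m := by exact_mod_cast hm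
  unfold sgrR
  push_cast
  field_simp

/-- The diagonal hole probabilities telescope against the right-exit probability. -/
theorem sum_holeP_self_add_sgrR_self {n j : ℤ} (hj1 : 1 ≤ j) (hjn : j ≤ n) :
    (∑ x ∈ Finset.Icc (1 : ℤ) (j - 1), holeP (n - x) (n - x)) + sgrR (n - j) (n - j)
      = ((n : ℚ) - 1) / (n + 1) := by
  induction j, hj1 using Int.leInduction with
  | base =>
    rw [sgrR_self (by omega)]
    simp only [sub_self, zero_lt_one, Finset.Icc_eq_empty_of_lt, Finset.sum_empty, zero_add]
    push_cast
    congr 1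
    ring
  | succ k hk ih =>
    have hIcc : Finset.Icc (1 : ℤ) (k + 1 - 1) = insert k (Finset.Icc 1 (k - 1)) := by
      ext x
      simp only [Finset.mem_Icc, Finset.mem_insert]
      omega
    rw [← ih (by omega), hIcc, Finset.sum_insert (by simp), holeP_self (by omega),
      sgrR_self (by omega), sgrR_self (by omega)]
    have h : (k : ℚ) + 1 ≤ n := by exact_mod_cast hjn
    have h1 : (n : ℚ) - k + 1 ≠ 0 := by linarith
    have h2 : (n : ℚ) - k + 2 ≠ 0 := by linarith
    have h3 : (n : ℚ) - (k + 1) + 2 ≠ 0 := by linarith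
    push_cast
    field_simp
    ring

/-- The closed-form hole probability satisfies the bulk hole recurrence. -/
theorem hole_bulk_recurrence (n i j : ℤ) (hn : 2 ≤ n) (hi1 : 1 ≤ i) (hin : i ≤ n - 1)
    (hj1 : 1 ≤ j) (hjn : j ≤ n) :
    holeP n i = sgrR (n - 1) i * holeP n n
      + (∑ x ∈ Finset.Icc (1 : ℤ) (j - 1), holeP (n - 1) i * holeP (n - x) (n - x))
      + holeP (n - 1) i * sgrR (n - j) (n - j) := by
  rw [← Finset.mul_sum, add_assoc, ← mul_add, sum_holeP_self_add_sgrR_self hj1 hjn,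
    holeP_self (by omega)]
  have h : (2 : ℚ) ≤ n := by exact_mod_cast hn
  have h1 : (n : ℚ) - 1 ≠ 0 := by linarith
  unfold holeP sgrR
  push_cast
  rw [show (n : ℚ) - 1 + 1 = n by ring, show (n : ℚ) - 1 + 2 = n + 1 by ring]
  field_simp
  ring
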